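/- Let C be a based complex of R-modules with a Morse matching M, let t = d − d̃ and let g̃, h̃ be the associated maps. Then for x ∈ C_α with α ∈ M⁰ ∩ I_n, the perturbed inclusion from the perturbation lemma is given in closed form by g(x) = Σ_{i≥0} (h̃t)^i g̃(x) = Σ_{β ∈ I_n} Γ_{β,α}(x). -/

import Mathlib

noncomputable section
attribute [local instance] Classical.propDecidable

open DirectSum

universe u v w

/-- Directed paths in a digraph on `ι` with edge relation `E`. -/
inductive MPath {ι : Type v} (E : ι → ι → Prop) : ι → ι → Type v
  | nil (α : ι) : MPath E α α
  | cons {α β γ : ι} : E α β → MPath E β γ → MPath E α γ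

section Morse

variable (R : Type u) [Ring R] (ι : Type v) [DecidableEq ι]
  (V : ι → Type w) [∀ α, AddCommGroup (V α)] [∀ α, Module R (V α)]

/-- The linear endomorphism of `⨁ α, V α` with components `D α β : V α →ₗ[R] V β`
(by convention `0` on summands whose family of components has infinite support). -/
def toLin (D : ∀ α β, V α →ₗ[R] V β) : (⨁ α, V α) →ₗ[R] ⨁ α, V α :=
  DirectSum.toModule R ι _ fun α =>
    if h : {β | D α β ≠ 0}.Finite then
      ∑ β ∈ h.toFinset, (DirectSum.lof R ι V β).comp (D α β)
    else 0

/-- `(deg, V, D)` is a based complex: the components `D α β : C_α → C_β` of the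
differential lower degree by one, each column is finite, and the total
differential squares to zero. -/
structure IsBasedComplex (deg : ι → ℤ) (D : ∀ α β, V α →ₗ[R] V β) : Prop where
  deg_cond : ∀ α β, deg β ≠ deg α - 1 → D α β = 0
  fin : ∀ α, {β | D α β ≠ 0}.Finite
  dsq : toLin R ι V D ∘ₗ toLin R ι V D = 0

/-- Edges of the Morse graph `G^M(C)`: edges of `G(C)` not in `M` together with
the reversals of the edges in `M`. -/
def MorseEdge (D : ∀ α β, V α →ₗ[R] V β) (M : Set (ι × ι)) (α β : ι) : Prop :=
  (D α β ≠ 0 ∧ (α, β) ∉ M) ∨ (β, α) ∈ M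

/-- `M` is a Morse matching on the based complex `(deg, V, D)`. -/
structure IsMorseMatching (deg : ι → ℤ) (D : ∀ α β, V α →ₗ[R] V β)
    (M : Set (ι × ι)) : Prop where
  edge : ∀ e ∈ M, D e.1 e.2 ≠ 0
  iso : ∀ e ∈ M, Function.Bijective (D e.1 e.2)
  matching : ∀ e ∈ M, ∀ e' ∈ M,
    e.1 = e'.1 ∨ e.1 = e'.2 ∨ e.2 = e'.1 ∨ e.2 = e'.2 → e = e'
  wf : ∃ r : ι → ι → Prop, WellFounded r ∧ (∀ a b c, r a b → r b c → r a c) ∧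
    ∀ α β γ, deg γ = deg α →
      MorseEdge R ι V D M α β → MorseEdge R ι V D M β γ → r γ α

end Morse

/-- The set `M⁰` of vertices not incident to any edge of `M`. -/
def MZero {ι : Type v} (M : Set (ι × ι)) : Set ι := {α | ∀ β, (α, β) ∉ M ∧ (β, α) ∉ M}

section Morse2

variable (R : Type u) [Ring R] (ι : Type v) [DecidableEq ι]
  (V : ι → Type w) [∀ α, AddCommGroup (V α)] [∀ α, Module R (V α)]

/-- The differential `d̃` of `C̃`, keeping only the components of edges in `M`. -/
def dTilde (D : ∀ α β, V α →ₗ[R] V β) (M : Set (ι × ι)) :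
    (⨁ α, V α) →ₗ[R] ⨁ α, V α :=
  toLin R ι V fun α β => if (α, β) ∈ M then D α β else 0

/-- The degree one map `h̃`, sending `x ∈ C_α` to `-d⁻¹_{α,β} x` when `β → α ∈ M`. -/
def hTilde (D : ∀ α β, V α →ₗ[R] V β) (M : Set (ι × ι)) :
    (⨁ α, V α) →ₗ[R] ⨁ α, V α :=
  DirectSum.toModule R ι _ fun α =>
    if h : ∃ β, (β, α) ∈ M ∧ Function.Bijective (D β α) then
      -((DirectSum.lof R ι V h.choose).comp
        (LinearEquiv.ofBijective (D h.choose α) h.choose_spec.2).symm.toLinearMap)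
    else 0

/-- The projection `f̃ : C̃ → C̃^M`. -/
def fTilde (M : Set (ι × ι)) : (⨁ α, V α) →ₗ[R] ⨁ s : MZero M, V s.1 :=
  DirectSum.toModule R ι _ fun α =>
    if h : α ∈ MZero M then
      DirectSum.lof R (MZero M) (fun s => V s.1) ⟨α, h⟩
    else 0

/-- The inclusion `g̃ : C̃^M → C̃`. -/
def gTilde (M : Set (ι × ι)) : (⨁ s : MZero M, V s.1) →ₗ[R] ⨁ α, V α :=
  DirectSum.toModule R (MZero M) _ fun s => DirectSum.lof R ι V s.1

/-- The map attached to an edge `σ → τ` of the Morse graph: `-d⁻¹_{σ,τ}` if it is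
the reversal of an edge of `M`, and the component `d_{τ,σ}` otherwise. -/
def edgeMap (D : ∀ α β, V α →ₗ[R] V β) (M : Set (ι × ι)) (σ τ : ι) :
    V σ →ₗ[R] V τ :=
  if h : (τ, σ) ∈ M ∧ Function.Bijective (D τ σ) then
    -(LinearEquiv.ofBijective (D τ σ) h.2).symm.toLinearMap
  else D σ τ

/-- The map `C_α → C_β` attached to a directed path in the Morse graph. -/
def pathMap (D : ∀ α β, V α →ₗ[R] V β) (M : Set (ι × ι)) :
    {α β : ι} → MPath (MorseEdge R ι V D M) α β → (V α →ₗ[R] V β)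
  | _, _, .nil _ => LinearMap.id
  | _, _, .cons _e p => (pathMap D M p).comp (edgeMap R ι V D M _ _)

/-- `Γ_{β,α} : C_α → C_β`, the sum over all directed paths from `α` to `β` in the
Morse graph of the associated path maps. -/
def Gamma (D : ∀ α β, V α →ₗ[R] V β) (M : Set (ι × ι)) (α β : ι) :
    V α →ₗ[R] V β :=
  ∑ᶠ p : MPath (MorseEdge R ι V D M) α β, pathMap R ι V D M p

end Morse2

section MorsePaths

variable {R : Type u} [Ring R] {ι : Type v} [DecidableEq ι]
  {V : ι → Type w} [∀ α, AddCommGroup (V α)] [∀ α, Module R (V α)]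
  {deg : ι → ℤ} {D : ∀ α β, V α →ₗ[R] V β} {M : Set (ι × ι)}

lemma toLin_lof (D : ∀ α β, V α →ₗ[R] V β) (α : ι) (F : Finset ι)
    (hF : ∀ β ∉ F, D α β = 0) (x : V α) :
    toLin R ι V D (DirectSum.lof R ι V α x) = ∑ β ∈ F, DirectSum.lof R ι V β (D α β x) := by
  have hsub : {β | D α β ≠ 0} ⊆ (F : Set ι) := fun β hβ => by
    by_contra h
    exact hβ (hF β h)
  have hfin : {β | D α β ≠ 0}.Finite := F.finite_toSet.subset hsub
  rw [toLin, DirectSum.toModule_lof, dif_pos hfin, LinearMap.sum_apply]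
  refine Finset.sum_subset (fun β hβ => hsub (hfin.mem_toFinset.1 hβ)) fun β _ hβ => ?_
  have h0 : D α β = 0 := by
    by_contra h
    exact hβ (hfin.mem_toFinset.2 h)
  simp [h0]

lemma IsMorseMatching.left_unique (hM : IsMorseMatching R ι V deg D M) {β γ γ' : ι}
    (h : (γ, β) ∈ M) (h' : (γ', β) ∈ M) : γ = γ' :=
  congrArg Prod.fst (hM.matching _ h _ h' (by simp))

lemma IsBasedComplex.deg_of_ne_zero (hC : IsBasedComplex R ι V deg D) {α β : ι}
    (h : D α β ≠ 0) : deg β = deg α - 1 := by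
  by_contra h'
  exact h (hC.deg_cond α β h')

/-- The first vertex of an edge of `M` is not the second vertex of another one. -/
lemma IsMorseMatching.source_not_target (hC : IsBasedComplex R ι V deg D)
    (hM : IsMorseMatching R ι V deg D M) {β γ : ι} (h : (γ, β) ∈ M) (δ : ι) :
    (δ, γ) ∉ M := by
  intro h'
  have he := hM.matching _ h _ h' (by simp)
  have h1 : β = γ := congrArg Prod.snd he
  have h2 := hC.deg_of_ne_zero (hM.edge _ h)
  simp only [h1] at h2
  omega

lemma edgeMap_of_mem (hM : IsMorseMatching R ι V deg D M) {β γ : ι} (h : (γ, β) ∈ M) :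
    edgeMap R ι V D M β γ =
      -(LinearEquiv.ofBijective (D γ β) (hM.iso _ h)).symm.toLinearMap := by
  rw [edgeMap, dif_pos ⟨h, hM.iso _ h⟩]

lemma edgeMap_of_ne_zero (hC : IsBasedComplex R ι V deg D)
    (hM : IsMorseMatching R ι V deg D M) {α β : ι} (h : D α β ≠ 0) :
    edgeMap R ι V D M α β = D α β := by
  rw [edgeMap, dif_neg]
  rintro ⟨h', -⟩
  have h1 := hC.deg_of_ne_zero h
  have h2 := hC.deg_of_ne_zero (hM.edge _ h')
  simp only at h2
  omega

lemma hTilde_lof_of_mem (hM : IsMorseMatching R ι V deg D M) {β γ : ι} (h : (γ, β) ∈ M)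
    (y : V β) :
    hTilde R ι V D M (DirectSum.lof R ι V β y) =
      DirectSum.lof R ι V γ (edgeMap R ι V D M β γ y) := by
  have hex : ∃ γ, (γ, β) ∈ M ∧ Function.Bijective (D γ β) := ⟨γ, h, hM.iso _ h⟩
  have key : ∀ γ' (h' : (γ', β) ∈ M),
      (-((DirectSum.lof R ι V γ').comp
        (LinearEquiv.ofBijective (D γ' β) (hM.iso _ h')).symm.toLinearMap)) y =
      DirectSum.lof R ι V γ (edgeMap R ι V D M β γ y) := by
    intro γ' h'
    obtain rfl := hM.left_unique h h'
    rw [edgeMap_of_mem hM h]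
    simp
  rw [hTilde, DirectSum.toModule_lof, dif_pos hex]
  exact key _ hex.choose_spec.1

lemma hTilde_lof_of_not_mem {β : ι} (h : ∀ γ, (γ, β) ∉ M) (y : V β) :
    hTilde R ι V D M (DirectSum.lof R ι V β y) = 0 := by
  rw [hTilde, DirectSum.toModule_lof, dif_neg (by rintro ⟨γ, hγ, -⟩; exact h γ hγ)]
  rfl

/-- A directed path in the Morse graph ends at most one degree above its start, and does not
end above its start if it cannot start with a reversed matching edge. -/
lemma MPath.deg_le (hC : IsBasedComplex R ι V deg D) (hM : IsMorseMatching R ι V deg D M)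
    {α β : ι} (p : MPath (MorseEdge R ι V D M) α β) :
    deg β ≤ deg α + 1 ∧ ((∀ δ, (δ, α) ∉ M) → deg β ≤ deg α) := by
  induction p with
  | nil α => exact ⟨by omega, fun _ => le_rfl⟩
  | cons e p ih =>
    rcases e with ⟨hD, -⟩ | h
    · have := hC.deg_of_ne_zero hD
      exact ⟨by omega, fun _ => by omega⟩
    · have h1 := ih.2 (hM.source_not_target hC h)
      have h2 := hC.deg_of_ne_zero (hM.edge _ h)
      simp only at h2
      exact ⟨by omega, fun h' => absurd h (h' _)⟩

variable (R V deg D M) in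
/-- Directed paths in the Morse graph starting at `α` and ending in the degree of `α`. -/
abbrev LevelPath (α : ι) : Type v :=
  Σ β : {β : ι | deg β = deg α}, MPath (MorseEdge R ι V D M) α β

variable (R V D M) in
/-- Zigzags `α → β → γ` consisting of an edge of `G(C)` outside `M` and a reversed edge of `M`. -/
abbrev Zigzag (α : ι) : Type v :=
  {q : ι × ι // (D α q.1 ≠ 0 ∧ (α, q.1) ∉ M) ∧ (q.2, q.1) ∈ M}

/-- The map attached to a zigzag. -/
def Zigzag.map {α : ι} (s : Zigzag R V D M α) : V α →ₗ[R] V s.1.2 :=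
  (edgeMap R ι V D M s.1.1 s.1.2).comp (edgeMap R ι V D M α s.1.1)

lemma Zigzag.fst_injective (hM : IsMorseMatching R ι V deg D M) (α : ι) :
    Function.Injective fun s : Zigzag R V D M α => s.1.1 := by
  rintro ⟨⟨β, γ⟩, h1, h2⟩ ⟨⟨β', γ'⟩, h1', h2'⟩ (rfl : β = β')
  obtain rfl := hM.left_unique h2 h2'
  rfl

lemma Zigzag.finite (hC : IsBasedComplex R ι V deg D) (hM : IsMorseMatching R ι V deg D M)
    (α : ι) : Finite (Zigzag R V D M α) := by
  have := (hC.fin α).to_subtype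
  refine Finite.of_injective
    (fun s : Zigzag R V D M α => (⟨s.1.1, s.2.1.1⟩ : {β | D α β ≠ 0})) fun s s' h => ?_
  exact Zigzag.fst_injective hM α (congrArg Subtype.val h)

lemma Zigzag.deg_eq (hC : IsBasedComplex R ι V deg D) (hM : IsMorseMatching R ι V deg D M)
    {α : ι} (s : Zigzag R V D M α) : deg s.1.2 = deg α := by
  have h1 := hC.deg_of_ne_zero s.2.1.1
  have h2 := hC.deg_of_ne_zero (hM.edge _ s.2.2)
  simp only at h2
  omega

/-- Applying `h̃ t` to a homogeneous element sums over zigzags. -/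
lemma hTilde_comp_lof (hC : IsBasedComplex R ι V deg D) (hM : IsMorseMatching R ι V deg D M)
    (α : ι) [Fintype (Zigzag R V D M α)] (x : V α) :
    (hTilde R ι V D M ∘ₗ (toLin R ι V D - dTilde R ι V D M)) (DirectSum.lof R ι V α x) =
      ∑ s : Zigzag R V D M α, DirectSum.lof R ι V s.1.2 (s.map x) := by
  have hF : ∀ β ∉ (hC.fin α).toFinset, D α β = 0 := fun β hβ => by simpa using hβ
  rw [LinearMap.comp_apply, LinearMap.sub_apply, dTilde, toLin_lof D α _ hF,
    toLin_lof _ α (hC.fin α).toFinset (fun β hβ => by simp [hF β hβ]),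
    ← Finset.sum_sub_distrib, map_sum]
  symm
  refine Finset.sum_of_injOn (fun s => s.1.1) (Zigzag.fst_injective hM α).injOn
    (fun s _ => by simpa using s.2.1.1) (fun β hβ hns => ?_) fun s _ => ?_
  · by_cases hm : (α, β) ∈ M
    · simp [hm]
    · rw [← map_sub]
      refine hTilde_lof_of_not_mem (fun γ hγ => hns ?_) _
      exact ⟨⟨(β, γ), ⟨by simpa using hβ, hm⟩, hγ⟩, by simp, rfl⟩
  · rw [if_neg s.2.1.2, LinearMap.zero_apply, map_zero, sub_zero,
      hTilde_lof_of_mem hM s.2.2, Zigzag.map, LinearMap.comp_apply,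
      edgeMap_of_ne_zero hC hM s.2.1.1]

/-- The trivial path at `α`, or a zigzag followed by a path. -/
def LevelPath.glue (hC : IsBasedComplex R ι V deg D) (hM : IsMorseMatching R ι V deg D M)
    (α : ι) :
    Option (Σ s : Zigzag R V D M α, LevelPath R V deg D M s.1.2) → LevelPath R V deg D M α
  | none => ⟨⟨α, rfl⟩, .nil α⟩
  | some ⟨s, ⟨β, p⟩⟩ =>
    ⟨⟨β.1, β.2.trans (s.deg_eq hC hM)⟩, .cons (.inl s.2.1) (.cons (.inr s.2.2) p)⟩

lemma LevelPath.glue_bijective (hC : IsBasedComplex R ι V deg D)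
    (hM : IsMorseMatching R ι V deg D M) {α : ι} (hα : ∀ δ, (δ, α) ∉ M) :
    Function.Bijective (LevelPath.glue hC hM α) := by
  constructor
  · rintro (_ | ⟨⟨⟨b, c⟩, hs⟩, ⟨β, hβ⟩, p⟩) (_ | ⟨⟨⟨b', c'⟩, hs'⟩, ⟨β', hβ'⟩, p'⟩) h
    · rfl
    · simp only [LevelPath.glue, Sigma.mk.injEq, Subtype.mk.injEq] at h
      obtain ⟨h1, h2⟩ := h
      subst h1
      cases h2
    · simp only [LevelPath.glue, Sigma.mk.injEq, Subtype.mk.injEq] at h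
      obtain ⟨h1, h2⟩ := h
      subst h1
      cases h2
    · simp only [LevelPath.glue, Sigma.mk.injEq, Subtype.mk.injEq] at h
      obtain ⟨h1, h2⟩ := h
      subst h1
      cases h2
      rfl
  · rintro ⟨⟨β, hβ⟩, p⟩
    have hdeg : deg β = deg α := hβ
    change MPath (MorseEdge R ι V D M) α β at p
    cases p with
    | nil => exact ⟨none, rfl⟩
    | cons e p =>
      rcases e with he | he
      · have hd := hC.deg_of_ne_zero he.1
        cases p with
        | nil => omega
        | cons e' p =>
          rcases e' with he' | he'
          · have := hC.deg_of_ne_zero he'.1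
            have := (p.deg_le hC hM).1
            omega
          · let s : Zigzag R V D M α := ⟨(_, _), he, he'⟩
            exact ⟨some ⟨s, ⟨⟨β, hdeg.trans (s.deg_eq hC hM).symm⟩, p⟩⟩, rfl⟩
      · exact absurd he (hα _)

/-- The sum of all path maps out of `α` that preserve the degree. -/
def levelSum (R : Type u) [Ring R] {ι : Type v} [DecidableEq ι]
    (V : ι → Type w) [∀ α, AddCommGroup (V α)] [∀ α, Module R (V α)]
    (deg : ι → ℤ) (D : ∀ α β, V α →ₗ[R] V β) (M : Set (ι × ι)) (α : ι) (x : V α) : ⨁ α, V α :=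
  ∑ᶠ z : LevelPath R V deg D M α, DirectSum.lof R ι V z.1 (pathMap R ι V D M z.2 x)

lemma LevelPath.finite_of_zigzag (hC : IsBasedComplex R ι V deg D)
    (hM : IsMorseMatching R ι V deg D M) {α : ι} (hα : ∀ δ, (δ, α) ∉ M)
    (hfin : ∀ s : Zigzag R V D M α, Finite (LevelPath R V deg D M s.1.2)) :
    Finite (LevelPath R V deg D M α) := by
  have := Zigzag.finite hC hM α
  exact Finite.of_surjective _ (LevelPath.glue_bijective hC hM hα).2

lemma levelSum_eq (hC : IsBasedComplex R ι V deg D)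
    (hM : IsMorseMatching R ι V deg D M) {α : ι} (hα : ∀ δ, (δ, α) ∉ M)
    (hfin : ∀ s : Zigzag R V D M α, Finite (LevelPath R V deg D M s.1.2))
    [Fintype (Zigzag R V D M α)] (x : V α) :
    levelSum R V deg D M α x =
      DirectSum.lof R ι V α x +
        ∑ s : Zigzag R V D M α, levelSum R V deg D M s.1.2 (s.map x) := by
  have := fun s : Zigzag R V D M α => Fintype.ofFinite (LevelPath R V deg D M s.1.2)
  rw [levelSum, ← finsum_comp_equiv (Equiv.ofBijective _ (LevelPath.glue_bijective hC hM hα)),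
    finsum_eq_sum_of_fintype, Fintype.sum_option, Fintype.sum_sigma]
  congr 1
  refine Finset.sum_congr rfl fun s _ => ?_
  rw [levelSum, finsum_eq_sum_of_fintype]
  rfl

/-- Path sums stabilise the partial sums of the perturbation series. -/
lemma levelPath_finite_and_partial_sums (hC : IsBasedComplex R ι V deg D)
    (hM : IsMorseMatching R ι V deg D M) (α : ι) (hα : ∀ δ, (δ, α) ∉ M) :
    Finite (LevelPath R V deg D M α) ∧ ∃ N : ℕ, ∀ m ≥ N, ∀ x : V α,
      ∑ i ∈ Finset.range m,
        ((hTilde R ι V D M ∘ₗ (toLin R ι V D - dTilde R ι V D M)) ^ i)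
          (DirectSum.lof R ι V α x) = levelSum R V deg D M α x := by
  obtain ⟨r, hr, -, hstep⟩ := hM.wf
  induction α using hr.induction with
  | _ α ih =>
    have key := fun s : Zigzag R V D M α =>
      ih s.1.2 (hstep α s.1.1 s.1.2 (s.deg_eq hC hM) (.inl s.2.1) (.inr s.2.2))
        (hM.source_not_target hC s.2.2)
    have hfin := fun s => (key s).1
    choose N hN using fun s => (key s).2
    have := Zigzag.finite hC hM α
    have := Fintype.ofFinite (Zigzag R V D M α)
    refine ⟨LevelPath.finite_of_zigzag hC hM hα hfin, Finset.univ.sup N + 1, fun m hm x => ?_⟩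
    obtain ⟨m, rfl⟩ : ∃ k, m = k + 1 := ⟨m - 1, by omega⟩
    rw [levelSum_eq hC hM hα hfin, Finset.sum_range_succ', add_comm, pow_zero,
      Module.End.one_apply]
    congr 1
    simp_rw [pow_succ, Module.End.mul_apply, hTilde_comp_lof hC hM, map_sum]
    rw [Finset.sum_comm]
    refine Finset.sum_congr rfl fun s _ => hN s m ?_ _
    have := Finset.le_sup (f := N) (Finset.mem_univ s)
    omega

lemma finsum_lof_Gamma {α : ι} [Finite (LevelPath R V deg D M α)] (x : V α) :
    ∑ᶠ β ∈ {β : ι | deg β = deg α}, DirectSum.lof R ι V β (Gamma R ι V D M α β x) =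
      levelSum R V deg D M α x := by
  have hp : ∀ β : {β : ι | deg β = deg α}, Finite (MPath (MorseEdge R ι V D M) α β) :=
    fun β => Finite.of_injective
      (fun p => (⟨β, p⟩ : LevelPath R V deg D M α)) fun _ _ h => by simpa using h
  have := fun β => @Fintype.ofFinite _ (hp β)
  have := Fintype.ofFinite (LevelPath R V deg D M α)
  have hG : ∀ β : {β : ι | deg β = deg α},
      DirectSum.lof R ι V β (Gamma R ι V D M α β x) =
        ∑ p : MPath (MorseEdge R ι V D M) α β,
          DirectSum.lof R ι V β (pathMap R ι V D M p x) := fun β => by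
    rw [Gamma, finsum_eq_sum_of_fintype, LinearMap.sum_apply, map_sum]
  let B : Finset {β : ι | deg β = deg α} :=
    Finset.univ.image fun z : LevelPath R V deg D M α => z.1
  have hB : ∀ z : LevelPath R V deg D M α, z.1 ∈ B := fun z =>
    Finset.mem_image_of_mem _ (Finset.mem_univ z)
  rw [← finsum_set_coe_eq_finsum_mem, finsum_congr hG,
    finsum_eq_sum_of_support_subset (s := B), levelSum, finsum_eq_sum_of_fintype,
    Finset.sum_sigma']
  · refine Finset.sum_congr ?_ fun _ _ => rfl
    ext z
    simp [hB z]
  · intro β hβ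
    obtain ⟨p, -, -⟩ := Finset.exists_ne_zero_of_sum_ne_zero hβ
    exact hB ⟨β, p⟩

end MorsePaths

theorem perturbed_inclusion_closed_form
    (R : Type u) [Ring R] (ι : Type v) [DecidableEq ι]
    (V : ι → Type w) [∀ α, AddCommGroup (V α)] [∀ α, Module R (V α)]
    (deg : ι → ℤ) (D : ∀ α β, V α →ₗ[R] V β) (M : Set (ι × ι))
    (hC : IsBasedComplex R ι V deg D) (hM : IsMorseMatching R ι V deg D M)
    (t : (⨁ α, V α) →ₗ[R] ⨁ α, V α)
    (ht : t = toLin R ι V D - dTilde R ι V D M)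
    (α : ι) (hα : α ∈ MZero M) (x : V α) :
    ∑ᶠ i : ℕ, ((hTilde R ι V D M ∘ₗ t) ^ i)
        (gTilde R ι V M (DirectSum.lof R (MZero M) (fun s : MZero M => V s.1) ⟨α, hα⟩ x)) =
      ∑ᶠ β ∈ {β : ι | deg β = deg α},
        DirectSum.lof R ι V β (Gamma R ι V D M α β x) := by
  subst ht
  obtain ⟨hfin, N, hN⟩ := levelPath_finite_and_partial_sums hC hM α fun δ => (hα δ).2
  rw [finsum_lof_Gamma, ← hN N le_rfl, gTilde, DirectSum.toModule_lof]
  refine finsum_eq_sum_of_support_subset _ fun i hi => ?_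
  by_contra hlt
  have hle : N ≤ i := by simpa using hlt
  refine hi ?_
  have h := hN (i + 1) (by omega) x
  rwa [Finset.sum_range_succ, hN i hle, add_eq_left] at h
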